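/- For any normalized finite dataset, any scheduler pair (a_t, m_t), and any t ∈ (0,1) with a_t > 0 and m_t > 0, set α_t = ṁ_t/m_t, β_t = ȧ_t − a_t ṁ_t/m_t, and for x ∈ ℝ^d define the marginal posterior weights w_t(x_i | x) = exp(−‖x − a_t x_i‖²/(2 m_t²)) / ∑_{l=1}^n exp(−‖x − a_t x_l‖²/(2 m_t²)). Then the marginal kinetic energy density satisfies (1/(d n)) ∑_{j=1}^n E_{z∼N(0,I_d)} ‖α_t (a_t x_j + m_t z) + β_t ∑_{i=1}^n x_i w_t(x_i | a_t x_j + m_t z)‖² = (ṁ_t² + ȧ_t²) − β_t² (1 − λ(a_t/m_t)). -/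

import Mathlib

open MeasureTheory ProbabilityTheory Real

/-- Standard Gaussian measure `N(0, I_d)` on `ℝ^d`. -/
noncomputable def stdGaussian (d : ℕ) : Measure (EuclideanSpace ℝ (Fin d)) :=
  (Measure.pi fun _ : Fin d => gaussianReal 0 1).map (EuclideanSpace.equiv (Fin d) ℝ).symm

/-- Softmax posterior weights `ρ_s(x_i | y)`. -/
noncomputable def rho (d n : ℕ) (s : ℝ) (x : Fin n → EuclideanSpace ℝ (Fin d))
    (i : Fin n) (y : EuclideanSpace ℝ (Fin d)) : ℝ :=
  Real.exp (-(s ^ 2 / 2) * ‖x i - y‖ ^ 2) / ∑ l, Real.exp (-(s ^ 2 / 2) * ‖x l - y‖ ^ 2)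

/-- The data separation function `λ(s)`. -/
noncomputable def lamSep (d n : ℕ) (x : Fin n → EuclideanSpace ℝ (Fin d)) (s : ℝ) : ℝ :=
  (1 / ((d : ℝ) * n)) *
    ∑ j, ∫ z, ‖∑ i, rho d n s x i (x j + s⁻¹ • z) • x i‖ ^ 2 ∂ stdGaussian d

/-- Marginal posterior weights `w_t(x_i | y)` for the Gaussian path with scheduler `(a, m)`. -/
noncomputable def margWeight (d n : ℕ) (x : Fin n → EuclideanSpace ℝ (Fin d))
    (at_ mt : ℝ) (i : Fin n) (y : EuclideanSpace ℝ (Fin d)) : ℝ :=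
  Real.exp (-‖y - at_ • x i‖ ^ 2 / (2 * mt ^ 2)) /
    ∑ l, Real.exp (-‖y - at_ • x l‖ ^ 2 / (2 * mt ^ 2))

lemma sg_eq (d : ℕ) : _root_.stdGaussian d = ProbabilityTheory.stdGaussian (EuclideanSpace ℝ (Fin d)) := by
  rw [← map_pi_eq_stdGaussian]; rfl

noncomputable def gden (d : ℕ) (z : EuclideanSpace ℝ (Fin d)) : ℝ :=
  ((2 * π) ^ ((d : ℝ) / 2))⁻¹ * Real.exp (-‖z‖ ^ 2 / 2)

lemma gden_pos (d : ℕ) (z : EuclideanSpace ℝ (Fin d)) : 0 < gden d z := by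
  unfold gden; positivity

lemma gden_cont (d : ℕ) : Continuous (gden d) := by
  unfold gden; fun_prop

lemma gden_int (d : ℕ) : Integrable (gden d) := by
  have h := GaussianFourier.integrable_cexp_neg_mul_sq_norm_add (b := (1/2 : ℂ)) (by norm_num) 0
    (0 : EuclideanSpace ℝ (Fin d))
  have h2 := h.norm
  refine (h2.const_mul ((2 * π) ^ ((d : ℝ) / 2))⁻¹).congr (ae_of_all _ fun z => ?_)
  simp only [gden, Complex.norm_exp]
  congr 2
  simp [← Complex.ofReal_pow]
  ring

lemma sg_density (d : ℕ) :
    _root_.stdGaussian d = volume.withDensity (fun z => ENNReal.ofReal (gden d z)) := by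
  rw [sg_eq]
  have hfin : IsFiniteMeasure ((volume : Measure (EuclideanSpace ℝ (Fin d))).withDensity
      (fun z => ENNReal.ofReal (gden d z))) :=
    isFiniteMeasure_withDensity_ofReal (gden_int d).2
  apply Measure.ext_of_charFun
  ext w
  rw [charFun_stdGaussian, charFun_apply, integral_withDensity_eq_integral_toReal_smul
    (by have := gden_cont d; fun_prop) (by simp)]
  have h := GaussianFourier.integral_cexp_neg_mul_sq_norm_add (b := (1/2 : ℂ)) (by norm_num)
    Complex.I w
  have hC : (0:ℝ) < (2 * π) ^ ((d : ℝ) / 2) := by positivity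
  have : ∀ z : EuclideanSpace ℝ (Fin d), (ENNReal.ofReal (gden d z)).toReal •
      Complex.exp (inner ℝ z w * Complex.I) = (((2 * π) ^ ((d : ℝ) / 2) : ℝ) : ℂ)⁻¹ *
      Complex.exp (-(1/2) * (‖z‖ : ℂ) ^ 2 + Complex.I * inner ℝ w z) := by
    intro z
    rw [ENNReal.toReal_ofReal (gden_pos d z).le, Complex.exp_add, real_inner_comm]
    simp only [gden, Complex.real_smul]
    push_cast
    rw [mul_assoc]
    congr 3
    · congr 1; ring
    · ring_nf
  simp_rw [this]
  rw [integral_const_mul, h]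
  have e1 : (π / (1/2) : ℂ) ^ (Module.finrank ℝ (EuclideanSpace ℝ (Fin d)) / 2 : ℂ)
      = (((2 * π) ^ ((d : ℝ) / 2) : ℝ) : ℂ) := by
    rw [Complex.ofReal_cpow (by positivity)]
    simp
    congr 1; ring
  rw [e1, ← mul_assoc, inv_mul_cancel₀ (by exact_mod_cast hC.ne'), one_mul]
  congr 1
  simp; ring

lemma sg_integral (d : ℕ) (f : EuclideanSpace ℝ (Fin d) → ℝ) :
    ∫ z, f z ∂(_root_.stdGaussian d) = ∫ z, gden d z * f z := by
  rw [sg_density, integral_withDensity_eq_integral_toReal_smul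
    (by have := gden_cont d; fun_prop) (by simp)]
  simp [ENNReal.toReal_ofReal (gden_pos d _).le]

lemma sg_integrable (d : ℕ) (f : EuclideanSpace ℝ (Fin d) → ℝ) :
    Integrable f (_root_.stdGaussian d) ↔ Integrable (fun z => gden d z * f z) := by
  rw [sg_density, integrable_withDensity_iff_integrable_smul'
    (by have := gden_cont d; fun_prop) (by simp)]
  simp [ENNReal.toReal_ofReal (gden_pos d _).le]

instance sg_prob (d : ℕ) : IsProbabilityMeasure (_root_.stdGaussian d) := by
  rw [sg_eq]; infer_instance

lemma sg_norm_sq_integrable (d : ℕ) : Integrable (fun z => ‖z‖ ^ 2) (_root_.stdGaussian d) := by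
  rw [sg_eq]
  exact (IsGaussian.memLp_two_id).integrable_norm_pow (by norm_num)

lemma sg_inner_integrable (d : ℕ) (v : EuclideanSpace ℝ (Fin d)) :
    Integrable (fun z => inner ℝ z v) (_root_.stdGaussian d) := by
  rw [sg_eq]
  exact (IsGaussian.integrable_id).inner_const v

lemma sg_inner_integral (d : ℕ) (v : EuclideanSpace ℝ (Fin d)) :
    ∫ z, inner ℝ z v ∂(_root_.stdGaussian d) = 0 := by
  rw [sg_eq]
  have := integral_strongDual_stdGaussian (innerSL ℝ v)
  simpa [real_inner_comm] using this

lemma sg_norm_sq_integral (d : ℕ) : ∫ z, ‖z‖ ^ 2 ∂(_root_.stdGaussian d) = d := by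
  simp_rw [EuclideanSpace.real_norm_sq_eq]
  have hi : ∀ i : Fin d, Integrable (fun z : EuclideanSpace ℝ (Fin d) => z i ^ 2)
      (_root_.stdGaussian d) := fun i => by
    refine (sg_norm_sq_integrable d).mono' (by fun_prop) (ae_of_all _ fun z => ?_)
    rw [Real.norm_eq_abs, abs_of_nonneg (by positivity), EuclideanSpace.real_norm_sq_eq]
    exact Finset.single_le_sum (f := fun i => z i ^ 2) (fun i _ => by positivity) (Finset.mem_univ i)
  rw [integral_finsetSum _ (fun i _ => hi i)]
  have : ∀ i : Fin d, ∫ z : EuclideanSpace ℝ (Fin d), z i ^ 2 ∂(_root_.stdGaussian d) = 1 := by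
    intro i
    have hv := variance_dual_stdGaussian (E := EuclideanSpace ℝ (Fin d))
      (innerSL ℝ (EuclideanSpace.single i (1:ℝ)))
    rw [variance_of_integral_eq_zero (by fun_prop) (integral_strongDual_stdGaussian _)] at hv
    rw [sg_eq]
    simpa [EuclideanSpace.inner_single_left] using hv
  simp [this]

/-- Softmax weights in the normalized variable `u`. -/
noncomputable def Wt {d n : ℕ} (v : Fin n → EuclideanSpace ℝ (Fin d)) (i : Fin n)
    (u : EuclideanSpace ℝ (Fin d)) : ℝ :=
  gden d (u - v i) / ∑ l, gden d (u - v l)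

lemma sum_gden_pos {d n : ℕ} (v : Fin n → EuclideanSpace ℝ (Fin d)) (i : Fin n)
    (u : EuclideanSpace ℝ (Fin d)) : 0 < ∑ l, gden d (u - v l) :=
  Finset.sum_pos (fun l _ => gden_pos d _) ⟨i, Finset.mem_univ i⟩

lemma Wt_cont {d n : ℕ} (v : Fin n → EuclideanSpace ℝ (Fin d)) (i : Fin n) :
    Continuous (Wt v i) := by
  have := gden_cont d
  unfold Wt
  exact Continuous.div (by fun_prop) (by fun_prop) (fun u => (sum_gden_pos v i u).ne')

lemma Wt_bdd {d n : ℕ} (v : Fin n → EuclideanSpace ℝ (Fin d)) (i : Fin n)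
    (u : EuclideanSpace ℝ (Fin d)) : ‖Wt v i u‖ ≤ 1 := by
  have h := sum_gden_pos v i u
  rw [Real.norm_eq_abs, Wt, abs_of_nonneg (div_nonneg (gden_pos d _).le h.le), div_le_one h]
  exact Finset.single_le_sum (f := fun l => gden d (u - v l)) (fun l _ => (gden_pos d _).le)
    (Finset.mem_univ i)

lemma exp_quot {d n : ℕ} (v : Fin n → EuclideanSpace ℝ (Fin d)) (i : Fin n)
    (u : EuclideanSpace ℝ (Fin d)) :
    Real.exp (-‖u - v i‖ ^ 2 / 2) / ∑ l, Real.exp (-‖u - v l‖ ^ 2 / 2) = Wt v i u := by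
  have hC : (0:ℝ) < ((2 * π) ^ ((d : ℝ) / 2))⁻¹ := by positivity
  simp only [Wt, gden]
  rw [← Finset.mul_sum, mul_div_mul_left _ _ hC.ne']

lemma sg_integral_shift (d : ℕ) (v : EuclideanSpace ℝ (Fin d)) (f : EuclideanSpace ℝ (Fin d) → ℝ) :
    ∫ z, f (v + z) ∂(_root_.stdGaussian d) = ∫ u, gden d (u - v) * f u := by
  rw [sg_integral, ← integral_add_left_eq_self (fun u => gden d (u - v) * f u) v]
  simp

lemma sg_integrable_shift (d : ℕ) (v : EuclideanSpace ℝ (Fin d)) (f : EuclideanSpace ℝ (Fin d) → ℝ) :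
    Integrable (fun z => f (v + z)) (_root_.stdGaussian d) ↔
      Integrable (fun u => gden d (u - v) * f u) := by
  rw [sg_integrable]
  constructor
  · intro h
    simpa [sub_eq_add_neg, add_comm, add_left_comm] using h.comp_add_left (-v)
  · intro h
    simpa using h.comp_add_left v

lemma tower {d n : ℕ} (v : Fin n → EuclideanSpace ℝ (Fin d))
    (H : Fin n → EuclideanSpace ℝ (Fin d) → ℝ)
    (hH : ∀ i j, Integrable (fun z => H i (v j + z)) (_root_.stdGaussian d)) :
    ∑ j, ∫ z, ∑ i, Wt v i (v j + z) * H i (v j + z) ∂(_root_.stdGaussian d) =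
      ∑ i, ∫ z, H i (v i + z) ∂(_root_.stdGaussian d) := by
  have hWH : ∀ i j, Integrable (fun z => Wt v i (v j + z) * H i (v j + z))
      (_root_.stdGaussian d) := fun i j =>
    (hH i j).bdd_mul (c := 1)
      (((Wt_cont v i).comp (continuous_const.add continuous_id)).aestronglyMeasurable)
      (ae_of_all _ fun z => Wt_bdd v i _)
  have h1 : ∀ j, ∫ z, ∑ i, Wt v i (v j + z) * H i (v j + z) ∂(_root_.stdGaussian d) =
      ∑ i, ∫ u, gden d (u - v j) * (Wt v i u * H i u) := by
    intro j
    rw [integral_finsetSum _ (fun i _ => hWH i j)]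
    exact Finset.sum_congr rfl fun i _ => sg_integral_shift d (v j) (fun u => Wt v i u * H i u)
  simp_rw [h1]
  rw [Finset.sum_comm]
  refine Finset.sum_congr rfl fun i _ => ?_
  rw [← integral_finsetSum _ (fun j _ =>
    (sg_integrable_shift d (v j) (fun u => Wt v i u * H i u)).1 (hWH i j)), sg_integral_shift]
  refine integral_congr_ae (ae_of_all _ fun u => ?_)
  have h := sum_gden_pos v i u
  simp only []
  rw [← Finset.sum_mul, Wt]
  field_simp

lemma margWeight_eq {d n : ℕ} (x : Fin n → EuclideanSpace ℝ (Fin d)) {a m : ℝ} (hm : 0 < m)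
    (i j : Fin n) (z : EuclideanSpace ℝ (Fin d)) :
    margWeight d n x a m i (a • x j + m • z) =
      Wt (fun i => (a / m) • x i) i ((a / m) • x j + z) := by
  rw [← exp_quot, margWeight]
  have key : ∀ l, -‖a • x j + m • z - a • x l‖ ^ 2 / (2 * m ^ 2) =
      -‖(a / m) • x j + z - (a / m) • x l‖ ^ 2 / 2 := by
    intro l
    have : a • x j + m • z - a • x l = m • ((a / m) • x j + z - (a / m) • x l) := by
      rw [smul_sub, smul_add, smul_smul, smul_smul, mul_div_cancel₀ _ hm.ne']
    rw [this, norm_smul, mul_pow, Real.norm_eq_abs, sq_abs]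
    field_simp
  simp_rw [key]

lemma rho_eq {d n : ℕ} (x : Fin n → EuclideanSpace ℝ (Fin d)) {s : ℝ} (hs : 0 < s)
    (i j : Fin n) (z : EuclideanSpace ℝ (Fin d)) :
    rho d n s x i (x j + s⁻¹ • z) = Wt (fun i => s • x i) i (s • x j + z) := by
  rw [← exp_quot, rho]
  have key : ∀ l, -(s ^ 2 / 2) * ‖x l - (x j + s⁻¹ • z)‖ ^ 2 =
      -‖s • x j + z - s • x l‖ ^ 2 / 2 := by
    intro l
    have : s • x j + z - s • x l = (-s) • (x l - (x j + s⁻¹ • z)) := by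
      rw [neg_smul, smul_sub, smul_add, smul_smul, mul_inv_cancel₀ hs.ne', one_smul]; abel
    rw [this, norm_smul, mul_pow, Real.norm_eq_abs, sq_abs]
    ring
  simp_rw [key]

lemma ke_aux (d n : ℕ) (hd : 1 ≤ d) (hn : 1 ≤ n)
    (x : Fin n → EuclideanSpace ℝ (Fin d))
    (hvar : 1 / ((d : ℝ) * n) * ∑ i, ‖x i‖ ^ 2 = 1)
    (a m α β : ℝ) (ha : 0 < a) (hm : 0 < m) :
    (1 / ((d : ℝ) * n)) * ∑ j, ∫ z, ‖α • (a • x j + m • z) +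
        β • ∑ i, margWeight d n x a m i (a • x j + m • z) • x i‖ ^ 2 ∂ _root_.stdGaussian d
      = α ^ 2 * (a ^ 2 + m ^ 2) + 2 * α * β * a + β ^ 2 * lamSep d n x (a / m) := by
  have hs : 0 < a / m := by positivity
  set v : Fin n → EuclideanSpace ℝ (Fin d) := fun i => (a / m) • x i with hv
  have hDc : ∀ j, Continuous fun z => ∑ i, Wt v i (v j + z) • x i := fun j => by
    have := Wt_cont v
    fun_prop
  have hDb : ∀ u, ‖∑ i, Wt v i u • x i‖ ≤ ∑ i, ‖x i‖ := fun u =>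
    (norm_sum_le _ _).trans (Finset.sum_le_sum fun i _ => by
      rw [norm_smul]; exact mul_le_of_le_one_left (norm_nonneg _) (Wt_bdd v i u))
  have hD2 : ∀ j, Integrable (fun z => ‖∑ i, Wt v i (v j + z) • x i‖ ^ 2) (_root_.stdGaussian d) :=
    fun j => Integrable.of_bound ((hDc j).norm.pow 2).aestronglyMeasurable ((∑ i, ‖x i‖) ^ 2)
      (ae_of_all _ fun z => by
        rw [Real.norm_eq_abs, abs_of_nonneg (by positivity)]
        exact pow_le_pow_left₀ (norm_nonneg _) (hDb _) 2)
  have hyx : ∀ i j, Integrable (fun z => inner ℝ (a • x j + m • z) (x i)) (_root_.stdGaussian d) := by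
    intro i j
    simp_rw [inner_add_left, real_inner_smul_left]
    exact (integrable_const _).add ((sg_inner_integrable d (x i)).const_mul m)
  have hy2e : ∀ j (z : EuclideanSpace ℝ (Fin d)), ‖a • x j + m • z‖ ^ 2 =
      a ^ 2 * ‖x j‖ ^ 2 + 2 * a * m * inner ℝ z (x j) + m ^ 2 * ‖z‖ ^ 2 := by
    intro j z
    rw [norm_add_sq_real, norm_smul, norm_smul, mul_pow, mul_pow, real_inner_smul_left,
      real_inner_smul_right, Real.norm_eq_abs, Real.norm_eq_abs, sq_abs, sq_abs, real_inner_comm]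
    ring
  have hi1 : ∀ j, Integrable (fun z => a ^ 2 * ‖x j‖ ^ 2 + 2 * a * m * inner ℝ z (x j))
      (_root_.stdGaussian d) := fun j =>
    (integrable_const _).add ((sg_inner_integrable d (x j)).const_mul _)
  have hi2 : Integrable (fun z : EuclideanSpace ℝ (Fin d) => m ^ 2 * ‖z‖ ^ 2)
    (_root_.stdGaussian d) := (sg_norm_sq_integrable d).const_mul _
  have hy2 : ∀ j, Integrable (fun z => ‖a • x j + m • z‖ ^ 2) (_root_.stdGaussian d) := by
    intro j
    simp_rw [hy2e]
    exact (hi1 j).add hi2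
  have hy2i : ∀ j, ∫ z, ‖a • x j + m • z‖ ^ 2 ∂(_root_.stdGaussian d) =
      a ^ 2 * ‖x j‖ ^ 2 + m ^ 2 * d := by
    intro j
    simp_rw [hy2e]
    rw [integral_add (hi1 j) hi2, integral_add (integrable_const _)
      ((sg_inner_integrable d (x j)).const_mul _), integral_const, integral_const_mul, integral_const_mul,
      sg_inner_integral, sg_norm_sq_integral]
    simp
  have hmy : ∀ j (z : EuclideanSpace ℝ (Fin d)), m • (v j + z) = a • x j + m • z := by
    intro j z
    simp only [hv]
    rw [smul_add, smul_smul, mul_div_cancel₀ _ hm.ne']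
  have hyDe : ∀ j (z : EuclideanSpace ℝ (Fin d)),
      inner ℝ (a • x j + m • z) (∑ i, Wt v i (v j + z) • x i) =
      ∑ i, Wt v i (v j + z) * inner ℝ (m • (v j + z)) (x i) := by
    intro j z
    simp_rw [inner_sum, real_inner_smul_right, hmy]
  have hyD : ∀ j, Integrable (fun z => inner ℝ (a • x j + m • z)
      (∑ i, Wt v i (v j + z) • x i)) (_root_.stdGaussian d) := by
    intro j
    simp_rw [hyDe, hmy]
    exact integrable_finsetSum _ fun i _ => (hyx i j).bdd_mul (c := 1)
      (((Wt_cont v i).comp (continuous_const.add continuous_id)).aestronglyMeasurable)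
      (ae_of_all _ fun z => Wt_bdd v i _)
  have hT : ∑ j, ∫ z, inner ℝ (a • x j + m • z) (∑ i, Wt v i (v j + z) • x i)
      ∂(_root_.stdGaussian d) = a * ∑ i, ‖x i‖ ^ 2 := by
    simp_rw [hyDe]
    rw [tower v (fun i u => inner ℝ (m • u) (x i)) (fun i j => by simpa only [hmy] using hyx i j),
      Finset.mul_sum]
    refine Finset.sum_congr rfl fun i _ => ?_
    simp_rw [hmy, inner_add_left, real_inner_smul_left]
    rw [integral_add (integrable_const _) ((sg_inner_integrable d (x i)).const_mul m),
      integral_const, integral_const_mul, sg_inner_integral]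
    simp
  have hL : lamSep d n x (a / m) = 1 / ((d : ℝ) * n) *
      ∑ j, ∫ z, ‖∑ i, Wt v i (v j + z) • x i‖ ^ 2 ∂(_root_.stdGaussian d) := by
    unfold lamSep
    simp_rw [rho_eq x hs]
    rfl
  have hI : ∀ j, ∫ z, ‖α • (a • x j + m • z) +
        β • ∑ i, margWeight d n x a m i (a • x j + m • z) • x i‖ ^ 2 ∂ _root_.stdGaussian d
      = α ^ 2 * (a ^ 2 * ‖x j‖ ^ 2 + m ^ 2 * d) + 2 * α * β *
        (∫ z, inner ℝ (a • x j + m • z) (∑ i, Wt v i (v j + z) • x i) ∂(_root_.stdGaussian d))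
        + β ^ 2 * ∫ z, ‖∑ i, Wt v i (v j + z) • x i‖ ^ 2 ∂(_root_.stdGaussian d) := by
    intro j
    have e : ∀ z : EuclideanSpace ℝ (Fin d), ‖α • (a • x j + m • z) +
        β • ∑ i, margWeight d n x a m i (a • x j + m • z) • x i‖ ^ 2 =
        α ^ 2 * ‖a • x j + m • z‖ ^ 2 + 2 * α * β *
          inner ℝ (a • x j + m • z) (∑ i, Wt v i (v j + z) • x i)
          + β ^ 2 * ‖∑ i, Wt v i (v j + z) • x i‖ ^ 2 := by
      intro z
      simp_rw [margWeight_eq x hm]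
      rw [norm_add_sq_real, norm_smul, norm_smul, mul_pow, mul_pow, real_inner_smul_left,
        real_inner_smul_right, Real.norm_eq_abs, Real.norm_eq_abs, sq_abs, sq_abs]
      ring
    simp_rw [e]
    have h12 : Integrable (fun z => α ^ 2 * ‖a • x j + m • z‖ ^ 2 + 2 * α * β *
          inner ℝ (a • x j + m • z) (∑ i, Wt v i (v j + z) • x i)) (_root_.stdGaussian d) :=
      ((hy2 j).const_mul _).add ((hyD j).const_mul _)
    rw [integral_add h12 ((hD2 j).const_mul _),
      integral_add ((hy2 j).const_mul _) ((hyD j).const_mul _), integral_const_mul,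
      integral_const_mul, integral_const_mul, hy2i]
  simp_rw [hI]
  rw [Finset.sum_add_distrib, Finset.sum_add_distrib, ← Finset.mul_sum, ← Finset.mul_sum,
    ← Finset.mul_sum, hT, Finset.sum_add_distrib, ← Finset.mul_sum, hL]
  have hd' : (0:ℝ) < d := by exact_mod_cast hd
  have hn' : (0:ℝ) < n := by exact_mod_cast hn
  have hS : ∑ i, ‖x i‖ ^ 2 = d * n := by
    field_simp at hvar
    linarith
  rw [hS]
  simp only [Finset.sum_const, Finset.card_univ, Fintype.card_fin, nsmul_eq_mul]
  field_simp

/-- For any normalized finite dataset, scheduler pair `(a_t, m_t)`, and `t ∈ (0,1)` with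
`a_t > 0`, `m_t > 0`, the marginal kinetic energy density equals
`(ṁ_t² + ȧ_t²) − β_t² (1 − λ(a_t/m_t))`, with `α_t = ṁ_t/m_t`, `β_t = ȧ_t − a_t ṁ_t/m_t`. -/
theorem marginal_ke_density_eq (d n : ℕ) (hd : 1 ≤ d) (hn : 1 ≤ n)
    (x : Fin n → EuclideanSpace ℝ (Fin d))
    (hmean : (n : ℝ)⁻¹ • ∑ i, x i = 0)
    (hvar : 1 / ((d : ℝ) * n) * ∑ i, ‖x i‖ ^ 2 = 1)
    (a m : ℝ → ℝ)
    (ha_nonneg : ∀ t ∈ Set.Icc (0 : ℝ) 1, 0 ≤ a t)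
    (hm_nonneg : ∀ t ∈ Set.Icc (0 : ℝ) 1, 0 ≤ m t)
    (ha_cont : ContinuousOn a (Set.Icc 0 1))
    (hm_cont : ContinuousOn m (Set.Icc 0 1))
    (ha_smooth : ContDiffOn ℝ (⊤ : ℕ∞) a (Set.Ioo 0 1))
    (hm_smooth : ContDiffOn ℝ (⊤ : ℕ∞) m (Set.Ioo 0 1))
    (ha0 : a 0 = 0) (ha1 : a 1 = 1) (hm0 : m 0 = 1) (hm1 : m 1 = 0)
    (t : ℝ) (ht : t ∈ Set.Ioo (0 : ℝ) 1) (hat : 0 < a t) (hmt : 0 < m t) :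
    (1 / ((d : ℝ) * n)) *
        ∑ j, ∫ z,
          ‖(deriv m t / m t) • (a t • x j + m t • z) +
              (deriv a t - a t * deriv m t / m t) •
                ∑ i, margWeight d n x (a t) (m t) i (a t • x j + m t • z) • x i‖ ^ 2
          ∂ stdGaussian d
      = ((deriv m t) ^ 2 + (deriv a t) ^ 2) -
          (deriv a t - a t * deriv m t / m t) ^ 2 * (1 - lamSep d n x (a t / m t)) := by
  rw [ke_aux d n hd hn x hvar (a t) (m t) _ _ hat hmt]
  field_simp
  ring
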